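/- Let K, N be positive naturals, G = [g_{ij}] a real K×N matrix, and k, k' : Fin K → {0,1} register labels that differ exactly at one index l. Then the no-decoherence condition — for every n : Fin N → {0,1}, ∑_{i=1}^{K} [(-1)^{k_i} - (-1)^{k'_i}] · ∑_{j=1}^{N} g_{ij}·(-1)^{n_j} = 0 — holds if and only if g_{l j} = 0 for every j ∈ Fin N, i.e. row l of the interaction matrix G vanishes. -/

import Mathlib

/-- A real linear form that vanishes on all sign vectors has zero coefficients. -/
theorem eq_zero_of_forall_sum_mul_sign_eq_zero {ι : Type*} [Fintype ι] [DecidableEq ι]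
    {a : ι → ℝ} (h : ∀ n : ι → Fin 2, ∑ j, a j * (-1 : ℝ) ^ (n j : ℕ) = 0) (j : ι) :
    a j = 0 := by
  have h0 := h fun _ => 0
  have h1 := h (Function.update (fun _ => 0) j 1)
  rw [← Finset.add_sum_erase _ _ (Finset.mem_univ j)] at h0 h1
  have hrest : ∑ i ∈ Finset.univ.erase j,
      a i * (-1 : ℝ) ^ (Function.update (fun _ => (0 : Fin 2)) j 1 i : ℕ) =
      ∑ i ∈ Finset.univ.erase j, a i * (-1 : ℝ) ^ ((0 : Fin 2) : ℕ) :=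
    Finset.sum_congr rfl fun i hi => by
      rw [Function.update_of_ne (Finset.ne_of_mem_erase hi)]
  rw [hrest, Function.update_self] at h1
  norm_num at h0 h1
  linarith

theorem sign_sub_sign_ne_zero {a b : Fin 2} (h : a ≠ b) :
    (-1 : ℝ) ^ (a : ℕ) - (-1 : ℝ) ^ (b : ℕ) ≠ 0 := by
  revert h
  fin_cases a <;> fin_cases b <;> norm_num

/-- **Cases 3(a), 3(b).** If `k, k'` differ exactly at one index `l`, then the
no-decoherence condition holds iff row `l` of the interaction matrix `G`
vanishes. -/
theorem stmt_7 (K N : ℕ) (hK : 0 < K) (hN : 0 < N)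
    (G : Fin K → Fin N → ℝ)
    (k k' : Fin K → Fin 2) (l : Fin K)
    (hdiff : k l ≠ k' l)
    (hsame : ∀ i, i ≠ l → k i = k' i) :
    (∀ n : Fin N → Fin 2,
        ∑ i, ((-1 : ℝ) ^ (k i : ℕ) - (-1 : ℝ) ^ (k' i : ℕ)) *
          ∑ j, G i j * (-1 : ℝ) ^ (n j : ℕ) = 0)
      ↔ ∀ j : Fin N, G l j = 0 := by
  have hsum : ∀ n : Fin N → Fin 2,
      ∑ i, ((-1 : ℝ) ^ (k i : ℕ) - (-1 : ℝ) ^ (k' i : ℕ)) *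
          ∑ j, G i j * (-1 : ℝ) ^ (n j : ℕ) =
        ((-1 : ℝ) ^ (k l : ℕ) - (-1 : ℝ) ^ (k' l : ℕ)) *
          ∑ j, G l j * (-1 : ℝ) ^ (n j : ℕ) := fun n =>
    Fintype.sum_eq_single l fun i hi => by rw [hsame i hi, sub_self, zero_mul]
  simp only [hsum, mul_eq_zero, sign_sub_sign_ne_zero hdiff, false_or]
  exact ⟨eq_zero_of_forall_sum_mul_sign_eq_zero, fun h n => by simp [h]⟩
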